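/- Consider the group homomorphism Φ from GL(2,ℤ) to the group of linear automorphisms of V given by Φ(γ) : X ↦ γXγᵀ. Then the kernel of Φ is {±I}, and the image of Φ is exactly the group O⁺(2,1;ℤ) of those linear automorphisms g of V which satisfy: g(L) = L, det(g(X)) = det X for all X ∈ V, and g(V⁺) = V⁺. Consequently PGL(2,ℤ) = GL(2,ℤ)/{±I} is isomorphic to O⁺(2,1;ℤ). -/

import Mathlib

open Matrix

noncomputable section

abbrev M2 : Type := Matrix (Fin 2) (Fin 2) ℝ

/-- GL(2,ℤ). -/
abbrev G : Type := (Matrix (Fin 2) (Fin 2) ℤ)ˣ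

/-- V: the subspace of symmetric real 2×2 matrices. -/
def symM : Submodule ℝ M2 where
  carrier := {X | X.IsSymm}
  add_mem' := fun ha hb => ha.add hb
  zero_mem' := by simp [Matrix.IsSymm]
  smul_mem' := fun c X hX => by
    simpa [Matrix.IsSymm, Matrix.transpose_smul] using congrArg (c • ·) hX

/-- An integer matrix viewed as a real matrix. -/
def mapR (γ : G) : M2 := (γ : Matrix (Fin 2) (Fin 2) ℤ).map (fun k => (k : ℝ))

/-- The lattice L ⊂ V: symmetric integer matrices with even diagonal. -/
def Lsub : Set symM :=
  {X | ∃ N : Matrix (Fin 2) (Fin 2) ℤ, Even (N 0 0) ∧ Even (N 1 1) ∧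
    (X : M2) = N.map (fun k => (k : ℝ))}

/-- The future light-cone V⁺ inside V. -/
def Vp : Set symM := {X | 0 < (X : M2).trace ∧ 0 < (X : M2).det}

def mk3 (x y z : ℝ) : symM := ⟨!![x, y; y, z], by
  show (!![x, y; y, z] : M2).IsSymm
  ext i j; fin_cases i <;> fin_cases j <;> rfl⟩

lemma exists_mk3 (X : symM) : ∃ x y z, X = mk3 x y z := by
  obtain ⟨X, hX⟩ := X
  have hX' : X.IsSymm := hX
  refine ⟨X 0 0, X 0 1, X 1 1, Subtype.ext ?_⟩
  ext i j
  fin_cases i <;> fin_cases j <;> simp [mk3]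
  exact hX'.apply 0 1

lemma mk3_inj {x y z x' y' z' : ℝ} (h : mk3 x y z = mk3 x' y' z') : x = x' ∧ y = y' ∧ z = z' := by
  have h1 : (mk3 x y z : M2) = mk3 x' y' z' := congrArg _ h
  have a := congrFun (congrFun h1 0) 0
  have b := congrFun (congrFun h1 0) 1
  have c := congrFun (congrFun h1 1) 1
  simp [mk3] at a b c
  exact ⟨a, b, c⟩

lemma mk3_det (x y z : ℝ) : (mk3 x y z : M2).det = x * z - y * y := by
  simp [mk3, Matrix.det_fin_two]

lemma mk3_mem_Vp (x y z : ℝ) : mk3 x y z ∈ Vp ↔ 0 < x + z ∧ 0 < x * z - y * y := by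
  simp [Vp, mk3, Matrix.det_fin_two, Matrix.trace_fin_two]

lemma mk3_mem_L (x y z : ℝ) : mk3 x y z ∈ Lsub ↔
    ∃ p q r : ℤ, x = 2 * p ∧ y = q ∧ z = 2 * r := by
  constructor
  · rintro ⟨N, ⟨p, hp⟩, ⟨r, hr⟩, h⟩
    have a := congrFun (congrFun h 0) 0
    have b := congrFun (congrFun h 0) 1
    have c := congrFun (congrFun h 1) 1
    simp [mk3] at a b c
    refine ⟨p, N 0 1, r, ?_, b, ?_⟩
    · rw [a, hp]; push_cast; ring
    · rw [c, hr]; push_cast; ring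
  · rintro ⟨p, q, r, rfl, rfl, rfl⟩
    refine ⟨!![2 * p, q; q, 2 * r], by simp, by simp, ?_⟩
    ext i j
    fin_cases i <;> fin_cases j <;> simp [mk3]

lemma mapR_mul (γ δ : G) : mapR (γ * δ) = mapR γ * mapR δ := by
  ext i j
  simp [mapR, Matrix.mul_apply]

lemma mapR_one : mapR 1 = 1 := by
  ext i j
  fin_cases i <;> fin_cases j <;> simp [mapR]

def phiLin (γ : G) : symM →ₗ[ℝ] symM where
  toFun X := ⟨mapR γ * (X : M2) * (mapR γ)ᵀ, by
    show (mapR γ * (X : M2) * (mapR γ)ᵀ).IsSymm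
    have hX : (X : M2)ᵀ = X := X.2
    simp [Matrix.IsSymm, Matrix.transpose_mul, hX, Matrix.mul_assoc]⟩
  map_add' X Y := by
    apply Subtype.ext
    simp [Matrix.mul_add, Matrix.add_mul]
  map_smul' c X := by
    apply Subtype.ext
    simp

lemma phiLin_mul (γ δ : G) (X : symM) : phiLin (γ * δ) X = phiLin γ (phiLin δ X) := by
  apply Subtype.ext
  simp [phiLin, mapR_mul, Matrix.transpose_mul, Matrix.mul_assoc]

lemma phiLin_one (X : symM) : phiLin 1 X = X := by
  apply Subtype.ext
  simp [phiLin, mapR_one]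

def phi : G →* (symM ≃ₗ[ℝ] symM) where
  toFun γ := LinearEquiv.ofLinearMap (phiLin γ) (phiLin γ⁻¹)
    (by ext1 X; simp [← phiLin_mul, phiLin_one]) (by ext1 X; simp [← phiLin_mul, phiLin_one])
  map_one' := by
    apply LinearEquiv.ext
    intro X
    exact phiLin_one X
  map_mul' γ δ := by
    apply LinearEquiv.ext
    intro X
    exact phiLin_mul γ δ X

lemma phi_coe (γ : G) (X : symM) : ((phi γ) X : M2) = mapR γ * (X : M2) * (mapR γ)ᵀ := rfl

lemma phi_mk3 (γ : G) (a b c d : ℤ) (h : (γ : Matrix (Fin 2) (Fin 2) ℤ) = !![a, b; c, d])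
    (x y z : ℝ) : phi γ (mk3 x y z) =
      mk3 (a * a * x + 2 * a * b * y + b * b * z)
        (a * c * x + (a * d + b * c) * y + b * d * z)
        (c * c * x + 2 * c * d * y + d * d * z) := by
  apply Subtype.ext
  rw [phi_coe, mapR, h]
  ext i j
  fin_cases i <;> fin_cases j <;>
    simp [mk3, Matrix.mul_apply, Fin.sum_univ_two] <;> ring

lemma exists_entries (γ : G) : ∃ a b c d : ℤ,
    (γ : Matrix (Fin 2) (Fin 2) ℤ) = !![a, b; c, d] ∧ (a * d - b * c) ^ 2 = 1 := by
  refine ⟨_, _, _, _, Matrix.eta_fin_two _, ?_⟩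
  have h : IsUnit (γ : Matrix (Fin 2) (Fin 2) ℤ).det := (Matrix.isUnit_iff_isUnit_det _).1 γ.isUnit
  rw [Matrix.det_fin_two] at h
  exact Int.isUnit_iff_abs_eq.1 h |> fun h => by rw [← sq_abs, h, one_pow]

lemma phi_det (γ : G) (X : symM) : ((phi γ X : symM) : M2).det = (X : M2).det := by
  obtain ⟨x, y, z, rfl⟩ := exists_mk3 X
  obtain ⟨a, b, c, d, h, hd⟩ := exists_entries γ
  have hd' : ((a : ℝ) * d - b * c) ^ 2 = 1 := by exact_mod_cast hd
  rw [phi_mk3 γ a b c d h, mk3_det, mk3_det]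
  linear_combination (x * z - y * y) * hd'

lemma phi_L (γ : G) (X : symM) (hX : X ∈ Lsub) : phi γ X ∈ Lsub := by
  obtain ⟨x, y, z, rfl⟩ := exists_mk3 X
  obtain ⟨a, b, c, d, h, hd⟩ := exists_entries γ
  obtain ⟨p, q, r, rfl, rfl, rfl⟩ := (mk3_mem_L _ _ _).1 hX
  rw [phi_mk3 γ a b c d h, mk3_mem_L]
  refine ⟨a * a * p + a * b * q + b * b * r, 2 * a * c * p + (a * d + b * c) * q + 2 * b * d * r,
    c * c * p + c * d * q + d * d * r, ?_, ?_, ?_⟩ <;> push_cast <;> ring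

lemma phi_Vp (γ : G) (X : symM) (hX : X ∈ Vp) : phi γ X ∈ Vp := by
  have hdet := phi_det γ X
  obtain ⟨x, y, z, rfl⟩ := exists_mk3 X
  obtain ⟨a, b, c, d, h, hd⟩ := exists_entries γ
  rw [mk3_mem_Vp] at hX
  obtain ⟨h1, h2⟩ := hX
  rw [phi_mk3 γ a b c d h] at hdet ⊢
  rw [mk3_det, mk3_det] at hdet
  rw [mk3_mem_Vp, hdet]
  refine ⟨?_, h2⟩
  have hxz : 0 < x * z := by nlinarith [mul_self_nonneg y]
  have hx : 0 < x := by
    by_contra hx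
    have : 0 < z := by linarith
    nlinarith
  have key : ∀ u v : ℝ, 0 ≤ u * u * x + 2 * u * v * y + v * v * z := by
    intro u v
    have : 0 ≤ x * (u * u * x + 2 * u * v * y + v * v * z) := by
      have : x * (u * u * x + 2 * u * v * y + v * v * z)
        = (u * x + v * y) ^ 2 + v ^ 2 * (x * z - y * y) := by ring
      rw [this]; positivity
    exact nonneg_of_mul_nonneg_right this hx
  have k1 := key a b
  have k2 := key c d
  set A := (a * a * x + 2 * a * b * y + b * b * z : ℝ)
  set C := (c * c * x + 2 * c * d * y + d * d * z : ℝ)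
  set B := (a * c * x + (a * d + b * c) * y + b * d * z : ℝ)
  have hAC : 0 < A * C := by nlinarith [mul_self_nonneg B]
  rcases k1.lt_or_eq with h | h
  · linarith
  · rw [← h] at hAC; simp at hAC

lemma phi_image (γ : G) (S : Set symM) (hS : ∀ γ : G, ∀ X ∈ S, phi γ X ∈ S) :
    (⇑(phi γ)) '' S = S := by
  apply Set.Subset.antisymm
  · rintro _ ⟨X, hX, rfl⟩
    exact hS γ X hX
  · intro X hX
    refine ⟨phi γ⁻¹ X, hS _ _ hX, ?_⟩
    rw [← LinearEquiv.mul_apply, ← map_mul]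
    simp

lemma int_sq_aux (p q r : ℤ) (h : p * r = q ^ 2) (hc : IsCoprime p r) (hpos : 0 ≤ p + r) :
    ∃ a c : ℤ, p = a ^ 2 ∧ q = a * c ∧ r = c ^ 2 := by
  have hp : 0 ≤ p := by by_contra hp; nlinarith [sq_nonneg q]
  have hr : 0 ≤ r := by by_contra hr; nlinarith [sq_nonneg q]
  obtain ⟨a, ha⟩ := Int.sq_of_isCoprime hc h
  obtain ⟨c, hc'⟩ := Int.sq_of_isCoprime hc.symm (by rw [mul_comm]; exact h)
  have ha : p = a ^ 2 := by rcases ha with ha | ha <;> nlinarith [sq_nonneg a]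
  have hc' : r = c ^ 2 := by rcases hc' with ha | ha <;> nlinarith [sq_nonneg c]
  subst ha hc'
  have : q ^ 2 = (a * c) ^ 2 := by rw [← h]; ring
  rcases sq_eq_sq_iff_eq_or_eq_neg.1 this with h | h
  · exact ⟨a, c, rfl, h, rfl⟩
  · exact ⟨a, -c, rfl, by rw [h]; ring, by ring⟩

lemma int_main (p q r s t u w x z : ℤ) (h1 : p * r = q ^ 2) (h2 : s * u = t ^ 2)
    (h12 : p * u + r * s - 2 * q * t = 1) (h3 : x ^ 2 - 4 * w * z = 1)
    (h13 : p * z + r * w - q * x = 0) (h23 : s * z + u * w - t * x = 0)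
    (hp : 0 ≤ p + r) (hs : 0 ≤ s + u) :
    ∃ a b c d : ℤ, (a * d - b * c) ^ 2 = 1 ∧ p = a ^ 2 ∧ q = a * c ∧ r = c ^ 2 ∧
      s = b ^ 2 ∧ t = b * d ∧ u = d ^ 2 ∧ w = a * b ∧ x = a * d + b * c ∧ z = c * d := by
  have c1 : IsCoprime p r := by
    apply Int.isCoprime_iff_gcd_eq_one.2
    by_contra hne
    obtain ⟨l, hl, hd⟩ := Nat.exists_prime_and_dvd hne
    have hl' := Nat.prime_iff_prime_int.1 hl
    have d1 : (l : ℤ) ∣ p := (Int.natCast_dvd_natCast.2 hd).trans (Int.gcd_dvd_left ..)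
    have d2 : (l : ℤ) ∣ r := (Int.natCast_dvd_natCast.2 hd).trans (Int.gcd_dvd_right ..)
    have d3 : (l : ℤ) ∣ q := hl'.dvd_of_dvd_pow (h1 ▸ d1.mul_right r)
    apply hl'.not_isUnit
    apply isUnit_of_dvd_one
    rw [← h12]
    exact ((d1.mul_right _).add (d2.mul_right _)).sub ((d3.mul_left _).mul_right _)
  have c2 : IsCoprime s u := by
    apply Int.isCoprime_iff_gcd_eq_one.2
    by_contra hne
    obtain ⟨l, hl, hd⟩ := Nat.exists_prime_and_dvd hne
    have hl' := Nat.prime_iff_prime_int.1 hl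
    have d1 : (l : ℤ) ∣ s := (Int.natCast_dvd_natCast.2 hd).trans (Int.gcd_dvd_left ..)
    have d2 : (l : ℤ) ∣ u := (Int.natCast_dvd_natCast.2 hd).trans (Int.gcd_dvd_right ..)
    have d3 : (l : ℤ) ∣ t := hl'.dvd_of_dvd_pow (h2 ▸ d1.mul_right u)
    apply hl'.not_isUnit
    apply isUnit_of_dvd_one
    rw [← h12]
    exact ((d2.mul_left _).add (d1.mul_left _)).sub (d3.mul_left _)
  obtain ⟨a, c, rfl, rfl, rfl⟩ := int_sq_aux p q r h1 c1 hp
  obtain ⟨b, d, rfl, rfl, rfl⟩ := int_sq_aux s t u h2 c2 hs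
  have hδ : (a * d - b * c) ^ 2 = 1 := by linear_combination h12
  obtain ⟨k, hk⟩ : ∃ k, k = (a * d + b * c) * x - 2 * a * b * z - 2 * c * d * w := ⟨_, rfl⟩
  have hw : w = k * (a * b) := by
    rw [hk]; linear_combination (-w) * hδ + a ^ 2 * h23 + b ^ 2 * h13
  have hx : x = k * (a * d + b * c) := by
    rw [hk]; linear_combination (-x) * hδ + 2 * a * c * h23 + 2 * b * d * h13
  have hz : z = k * (c * d) := by
    rw [hk]; linear_combination (-z) * hδ + c ^ 2 * h23 + d ^ 2 * h13
  have hk2 : k ^ 2 = 1 := by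
    rw [hw, hx, hz] at h3
    linear_combination h3 - k ^ 2 * hδ
  rcases mul_self_eq_one_iff.1 ((sq k).symm.trans hk2) with rfl | rfl
  · exact ⟨a, b, c, d, hδ, rfl, rfl, rfl, rfl, rfl, rfl, by linarith, by linarith, by linarith⟩
  · exact ⟨a, -b, c, -d, by linear_combination hδ, rfl, rfl, rfl, by ring, by ring, by ring,
      by linarith, by linarith, by linarith⟩

lemma mk3_add (x y z x' y' z' : ℝ) : mk3 x y z + mk3 x' y' z' = mk3 (x + x') (y + y') (z + z') := by
  apply Subtype.ext
  ext i j
  fin_cases i <;> fin_cases j <;> simp [mk3]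

lemma mk3_smul (e x y z : ℝ) : e • mk3 x y z = mk3 (e * x) (e * y) (e * z) := by
  apply Subtype.ext
  ext i j
  fin_cases i <;> fin_cases j <;> simp [mk3]

/-- The image of half an isotropic lattice vector is an integer matrix. -/
lemma half_int (g : symM ≃ₗ[ℝ] symM) (hL : (⇑g) '' Lsub = Lsub)
    (hdet : ∀ X : symM, ((g X : M2)).det = (X : M2).det) (x z : ℝ) (hxz : x * z = 0)
    (hm : mk3 (2 * x) 0 (2 * z) ∈ Lsub) :
    ∃ p q r : ℤ, p * r = q ^ 2 ∧ g (mk3 x 0 z) = mk3 p q r := by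
  have h1 : g (mk3 (2 * x) 0 (2 * z)) ∈ Lsub := hL ▸ Set.mem_image_of_mem _ hm
  have h2 : mk3 (2 * x) 0 (2 * z) = (2 : ℝ) • mk3 x 0 z := by rw [mk3_smul]; simp
  have h3 := hdet (mk3 x 0 z)
  obtain ⟨X, Y, Z, hX⟩ := exists_mk3 (g (mk3 x 0 z))
  rw [h2, map_smul, hX, mk3_smul, mk3_mem_L] at h1
  obtain ⟨p, q, r, hp, hq, hr⟩ := h1
  rw [hX, mk3_det, mk3_det, hxz] at h3
  obtain rfl : X = p := by linarith
  obtain rfl : Z = r := by linarith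
  have h4 : q ^ 2 = 4 * (p * r) := by
    have : (q : ℝ) ^ 2 = 4 * (p * r) := by rw [← hq]; linarith
    exact_mod_cast this
  have h5 : Even q := by
    have : Even (q ^ 2) := by rw [h4]; exact ⟨2 * (p * r), by ring⟩
    exact (Int.even_pow.1 this).1
  obtain ⟨m, rfl⟩ := h5
  refine ⟨p, m, r, by linarith, ?_⟩
  rw [hX]
  push_cast at hq
  obtain rfl : Y = m := by linarith
  rfl

lemma nonneg_of_eps (A B : ℝ) (h : ∀ e : ℝ, 0 < e → 0 < A + e * B) : 0 ≤ A := by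
  by_contra hA
  push Not at hA
  have hB : 0 < 1 + |B| := by positivity
  have h1 := h (-A / (1 + |B|)) (div_pos (by linarith) hB)
  have h2 : A + -A / (1 + |B|) * B = A * (1 + |B| - B) / (1 + |B|) := by field_simp; ring
  rw [h2] at h1
  have h3 : A * (1 + |B| - B) < 0 := mul_neg_of_neg_of_pos hA (by linarith [le_abs_self B])
  exact absurd h1 (not_lt.2 (div_nonpos_of_nonpos_of_nonneg h3.le hB.le))

lemma surj (g : symM ≃ₗ[ℝ] symM) (hL : (⇑g) '' Lsub = Lsub)
    (hdet : ∀ X : symM, ((g X : M2)).det = (X : M2).det) (hV : (⇑g) '' Vp = Vp) :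
    ∃ γ : G, phi γ = g := by
  obtain ⟨p, q, r, h1, hP⟩ := half_int g hL hdet 1 0 (by simp)
    ((mk3_mem_L _ _ _).2 ⟨1, 0, 0, by simp, by simp, by simp⟩)
  obtain ⟨s, t, u, h2, hQ⟩ := half_int g hL hdet 0 1 (by simp)
    ((mk3_mem_L _ _ _).2 ⟨0, 0, 1, by simp, by simp, by simp⟩)
  obtain ⟨w, x, z, hW⟩ : ∃ w x z : ℤ, g (mk3 0 1 0) = mk3 (2 * w) x (2 * z) := by
    have h : g (mk3 0 1 0) ∈ Lsub := hL ▸ Set.mem_image_of_mem _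
      ((mk3_mem_L 0 1 0).2 ⟨0, 1, 0, by simp, by simp, by simp⟩)
    obtain ⟨X, Y, Z, hX⟩ := exists_mk3 (g (mk3 0 1 0))
    rw [hX, mk3_mem_L] at h
    obtain ⟨w, x, z, rfl, rfl, rfl⟩ := h
    exact ⟨w, x, z, hX⟩
  have hg : ∀ α β δ : ℝ, g (mk3 α β δ) = mk3 (α * p + β * (2 * w) + δ * s)
      (α * q + β * x + δ * t) (α * r + β * (2 * z) + δ * u) := by
    intro α β δ
    have : mk3 α β δ = α • mk3 1 0 0 + β • mk3 0 1 0 + δ • mk3 0 0 1 := by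
      simp [mk3_smul, mk3_add]
    rw [this, map_add, map_add, map_smul, map_smul, map_smul, hP, hQ, hW]
    simp [mk3_smul, mk3_add]
  have hd : ∀ α β δ : ℤ, (α * p + β * (2 * w) + δ * s) * (α * r + β * (2 * z) + δ * u)
      - (α * q + β * x + δ * t) * (α * q + β * x + δ * t) = α * δ - β * β := by
    intro α β δ
    have := hdet (mk3 α β δ)
    rw [hg, mk3_det, mk3_det] at this
    exact_mod_cast this
  have hpos : ∀ α δ : ℝ, 0 < α → 0 < δ → 0 < α * (p + r) + δ * (s + u) := by
    intro α δ hα hδ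
    have h : g (mk3 α 0 δ) ∈ Vp := hV ▸ Set.mem_image_of_mem _
      ((mk3_mem_Vp α 0 δ).2 ⟨by linarith, by nlinarith [mul_pos hα hδ]⟩)
    rw [hg, mk3_mem_Vp] at h
    linarith [h.1]
  have hp : 0 ≤ p + r := by
    have : (0 : ℝ) ≤ p + r := nonneg_of_eps _ (s + u) fun e he => by
      have := hpos 1 e one_pos he
      linarith
    exact_mod_cast this
  have hs : 0 ≤ s + u := by
    have : (0 : ℝ) ≤ s + u := nonneg_of_eps _ (p + r) fun e he => by
      have := hpos e 1 he one_pos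
      linarith
    exact_mod_cast this
  obtain ⟨a, b, c, d, hδ, rfl, rfl, rfl, rfl, rfl, rfl, rfl, rfl, rfl⟩ :=
    int_main p q r s t u w x z h1 h2 (by linear_combination hd 1 0 1 - h1 - h2)
      (by linear_combination -hd 0 1 0)
      (by
        have : 2 * (p * z + r * w - q * x) = 0 := by
          linear_combination hd 1 1 0 - h1 - hd 0 1 0
        linarith)
      (by
        have : 2 * (s * z + u * w - t * x) = 0 := by
          linear_combination hd 0 1 1 - h2 - hd 0 1 0
        linarith) hp hs
  have hu : IsUnit (!![a, b; c, d] : Matrix (Fin 2) (Fin 2) ℤ) := by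
    rw [Matrix.isUnit_iff_isUnit_det, Matrix.det_fin_two_of]
    exact IsUnit.of_pow_eq_one hδ two_ne_zero
  obtain ⟨γ, hγ⟩ := hu
  refine ⟨γ, LinearEquiv.ext fun X => ?_⟩
  obtain ⟨α, β, δ, rfl⟩ := exists_mk3 X
  rw [hg, phi_mk3 γ a b c d hγ]
  push_cast
  congr 1 <;> ring

lemma phi_ker : phi.ker = Subgroup.zpowers (-1 : G) := by
  apply le_antisymm
  · intro γ hγ
    rw [MonoidHom.mem_ker] at hγ
    obtain ⟨a, b, c, d, h, hd⟩ := exists_entries γ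
    have e1 : phi γ (mk3 1 0 0) = mk3 1 0 0 := by rw [hγ]; rfl
    have e2 : phi γ (mk3 0 1 0) = mk3 0 1 0 := by rw [hγ]; rfl
    have e3 : phi γ (mk3 0 0 1) = mk3 0 0 1 := by rw [hγ]; rfl
    rw [phi_mk3 γ a b c d h] at e1 e2 e3
    obtain ⟨x1, y1, z1⟩ := mk3_inj e1
    obtain ⟨x2, y2, z2⟩ := mk3_inj e2
    obtain ⟨x3, y3, z3⟩ := mk3_inj e3
    simp at x1 y1 z1 x2 y2 z2 x3 y3 z3
    subst z1 x3
    have ha : a * a = 1 := by exact_mod_cast x1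
    have had : a * d = 1 := by simp at y2; exact_mod_cast y2
    rcases mul_self_eq_one_iff.1 ha with rfl | rfl
    · obtain rfl : d = 1 := by linarith
      have : γ = 1 := Units.ext (by rw [h]; exact Matrix.one_fin_two.symm)
      rw [this]; exact one_mem _
    · obtain rfl : d = -1 := by linarith
      have : γ = -1 := Units.ext (by rw [h, Units.val_neg, Units.val_one, Matrix.one_fin_two]; simp)
      rw [this]; exact Subgroup.mem_zpowers _
  · rw [Subgroup.zpowers_le, MonoidHom.mem_ker]
    apply LinearEquiv.ext
    intro X
    apply Subtype.ext
    have : mapR (-1) = -1 := by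
      ext i j
      fin_cases i <;> fin_cases j <;> simp [mapR]
    rw [phi_coe, this]
    simp

/-- The homomorphism Φ : GL(2,ℤ) → Aut(V), Φ(γ) : X ↦ γXγᵀ, has kernel {±I} and range
exactly O⁺(2,1;ℤ) = {g ∈ Aut(V) : g(L) = L, det(g X) = det X, g(V⁺) = V⁺};
consequently PGL(2,ℤ) = GL(2,ℤ)/{±I} ≅ O⁺(2,1;ℤ). -/
theorem stmt5 :
    ∃ Φ : G →* (symM ≃ₗ[ℝ] symM),
      (∀ (γ : G) (X : symM), ((Φ γ) X : M2) = mapR γ * (X : M2) * (mapR γ)ᵀ) ∧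
      Φ.ker = Subgroup.zpowers (-1 : G) ∧
      ∀ g : symM ≃ₗ[ℝ] symM, g ∈ Φ.range ↔
        ((⇑g) '' Lsub = Lsub ∧ (∀ X : symM, ((g X : M2)).det = (X : M2).det) ∧
          (⇑g) '' Vp = Vp) := by
  refine ⟨phi, phi_coe, phi_ker, fun g => ⟨?_, ?_⟩⟩
  · rintro ⟨γ, rfl⟩
    exact ⟨phi_image γ _ phi_L, phi_det γ, phi_image γ _ phi_Vp⟩
  · rintro ⟨hL, hdet, hV⟩
    exact surj g hL hdet hV
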